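/- arXiv:1203.5770 — 5 statements merged into one kernel-verified Lean document; each statement's English description precedes it below -/
import Mathlib

section
/- Suppose 0 < γ' ≤ γ_n ≤ γ < 1 for all n ≥ 0, and let {(x_n, y_n)}_{n=0}^∞ be a solution of the system with positive initial conditions. Then for each fixed i ≥ 0, the quotient y_{i+n} / μ(i, n+2) tends to +∞ as n → ∞. -/
open Filter Topology

/-- The coefficient sequence extended to `ℤ` by the convention `γ₋₁ := γ₀`. -/
noncomputable def gext (γ : ℕ → ℝ) : ℤ → ℝ := fun j => if j < 0 then γ 0 else γ j.toNat

/-- `μ(i,1) = 1` and `μ(i,k) = ∏_{j=i-1}^{i+k-3} γ_j` for `k ≥ 2`. -/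
noncomputable def mu (γ : ℕ → ℝ) (i k : ℕ) : ℝ :=
  ∏ t ∈ Finset.range (k - 1), gext γ ((i : ℤ) - 1 + (t : ℤ))

/-- `φ(i,n) = ∑_{k=1}^n μ(i,k) x_{i+k}`. -/
noncomputable def phi (γ x : ℕ → ℝ) (i n : ℕ) : ℝ :=
  ∑ k ∈ Finset.Icc 1 n, mu γ i k * x (i + k)

/-- `w_n = (γ_{n-1} + x_n)/y_n`, where `γ₋₁ := γ₀` (Nat subtraction). -/
noncomputable def wseq (γ x y : ℕ → ℝ) (n : ℕ) : ℝ := (γ (n - 1) + x n) / y n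

lemma gext_pos {γ : ℕ → ℝ} (h : ∀ n, 0 < γ n) (j : ℤ) : 0 < gext γ j := by
  unfold gext
  split_ifs <;> exact h _

lemma gext_le {γ : ℕ → ℝ} {g : ℝ} (h : ∀ n, γ n ≤ g) (j : ℤ) : gext γ j ≤ g := by
  unfold gext
  split_ifs <;> exact h _

lemma mu_pos {γ : ℕ → ℝ} (h : ∀ n, 0 < γ n) (i k : ℕ) : 0 < mu γ i k :=
  Finset.prod_pos fun _ _ => gext_pos h _

lemma mu_le_pow {γ : ℕ → ℝ} {g : ℝ} (hpos : ∀ n, 0 < γ n) (h : ∀ n, γ n ≤ g) (i k : ℕ) :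
    mu γ i k ≤ g ^ (k - 1) := by
  unfold mu
  calc _ ≤ ∏ _t ∈ Finset.range (k - 1), g :=
        Finset.prod_le_prod (fun _ _ => (gext_pos hpos _).le) fun _ _ => gext_le h _
    _ = g ^ (k - 1) := by simp

lemma mu_add_three (γ : ℕ → ℝ) (i n : ℕ) : mu γ i (n + 3) = mu γ i (n + 2) * γ (i + n) := by
  have hj : gext γ ((i : ℤ) - 1 + ((n + 1 : ℕ) : ℤ)) = γ (i + n) := by
    have : (i : ℤ) - 1 + ((n + 1 : ℕ) : ℤ) = ((i + n : ℕ) : ℤ) := by push_cast; ring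
    rw [this, gext, if_neg (Int.natCast_nonneg _).not_gt, Int.toNat_natCast]
  unfold mu
  rw [show n + 3 - 1 = n + 1 + 1 from rfl, show n + 2 - 1 = n + 1 from rfl,
    Finset.prod_range_succ, hj]

/-- If `0 < γ' ≤ γₙ ≤ g < 1`, then for every solution with positive initial conditions and
every fixed `i`, `y_{i+n} / μ(i, n+2) → +∞` as `n → ∞`. -/
theorem stmt2 (γ x y : ℕ → ℝ) (γ' g : ℝ)
    (hγ' : 0 < γ') (hγlo : ∀ n, γ' ≤ γ n) (hγhi : ∀ n, γ n ≤ g) (hg : g < 1)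
    (hγpos : ∀ n, 0 < γ n)
    (hx0 : 0 < x 0) (hy0 : 0 < y 0)
    (hx : ∀ n, x (n + 1) = x n / y n)
    (hy : ∀ n, y (n + 1) = x n + γ n * y n) :
    ∀ i : ℕ, Filter.Tendsto (fun n => y (i + n) / mu γ i (n + 2)) Filter.atTop Filter.atTop := by
  intro i
  have hg0 : 0 < g := (hγpos 0).trans_le (hγhi 0)
  have hxy : ∀ n, 0 < x n ∧ 0 < y n := by
    intro n
    induction n with
    | zero => exact ⟨hx0, hy0⟩
    | succ n ih =>
      rw [hx, hy]
      exact ⟨div_pos ih.1 ih.2, add_pos ih.1 (mul_pos (hγpos n) ih.2)⟩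
  have hμ : ∀ k, 0 < mu γ i k := mu_pos hγpos i
  have hstep : ∀ n, y (i + (n + 1)) / mu γ i (n + 1 + 2) =
      y (i + n) / mu γ i (n + 2) + x (i + n) / mu γ i (n + 3) := by
    intro n
    have h1 := (hμ (n + 2)).ne'
    have h2 := (hγpos (i + n)).ne'
    rw [show i + (n + 1) = i + n + 1 from rfl, show n + 1 + 2 = n + 3 from rfl, hy, mu_add_three]
    field_simp
    ring
  have hmono : Monotone fun n => y (i + n) / mu γ i (n + 2) :=
    monotone_nat_of_le_succ fun n => by
      rw [hstep]
      exact le_add_of_nonneg_right (div_pos (hxy _).1 (hμ _)).le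
  refine (tendsto_atTop_of_monotone hmono).resolve_right ?_
  rintro ⟨l, hl⟩
  have hμ0 : Tendsto (fun n => mu γ i (n + 2)) atTop (𝓝 0) :=
    squeeze_zero (fun n => (hμ _).le) (fun n => mu_le_pow hγpos hγhi i (n + 2))
      ((tendsto_pow_atTop_nhds_zero_of_lt_one hg0.le hg).comp (tendsto_add_atTop_nat 1))
  have hy_lim : Tendsto (fun n => y (i + n)) atTop (𝓝 0) := by
    have h := hl.mul hμ0
    rw [mul_zero] at h
    exact h.congr fun n => div_mul_cancel₀ _ (hμ _).ne'
  obtain ⟨N, hN⟩ := eventually_atTop.1 (hy_lim.eventually_le_const one_pos)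
  have hx_lower : ∀ n, N ≤ n → x (i + N) ≤ x (i + n) := by
    intro n hn
    induction n, hn using Nat.le_induction with
    | base => exact le_rfl
    | succ n hn ih =>
      rw [show i + (n + 1) = i + n + 1 from rfl, hx]
      exact ih.trans (le_div_self (hxy _).1.le (hxy _).2 (hN n hn))
  have hdiff : Tendsto (fun n => x (i + n) / mu γ i (n + 3)) atTop (𝓝 0) := by
    have h := (hl.comp (tendsto_add_atTop_nat 1)).sub hl
    rw [sub_self] at h
    refine h.congr fun n => ?_
    simp only [Function.comp_apply]
    rw [hstep, add_sub_cancel_left]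
  obtain ⟨n, hn, hlt⟩ := ((eventually_ge_atTop N).and
    (hdiff.eventually_lt_const (hxy (i + N)).1)).exists
  have hle : x (i + n) ≤ x (i + n) / mu γ i (n + 3) :=
    le_div_self (hxy _).1.le (hμ _)
      ((mu_le_pow hγpos hγhi i (n + 3)).trans (pow_le_one₀ hg0.le hg.le))
  exact absurd hlt ((hx_lower n hn).trans hle).not_gt
end

section
/- Let {(x_n, y_n)}_{n=0}^∞ be a solution of the system with positive initial conditions. Then for all i ≥ 0 and all n ≥ 1, the identity w_i = (x_i + γ_{i-1}) / y_i = φ(i,n) + μ(i, n+1) · w_{i+n} holds. -/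
open Filter Topology

lemma gext_natCast_sub_one (γ : ℕ → ℝ) (m : ℕ) : gext γ ((m : ℤ) - 1) = γ (m - 1) := by
  cases m <;> simp [gext]

lemma mu_add_two (γ : ℕ → ℝ) (i n : ℕ) :
    mu γ i (n + 2) = mu γ i (n + 1) * γ (i + n - 1) := by
  have h : (i : ℤ) - 1 + n = ((i + n : ℕ) : ℤ) - 1 := by push_cast; ring
  simp only [mu, Nat.add_succ_sub_one, Nat.add_zero, Finset.prod_range_succ, h,
    gext_natCast_sub_one]

lemma phi_succ (γ x : ℕ → ℝ) (i n : ℕ) :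
    phi γ x i (n + 1) = phi γ x i n + mu γ i (n + 1) * x (i + (n + 1)) :=
  Finset.sum_Icc_succ_top (Nat.le_add_left 1 n) _

lemma solution_pos {γ x y : ℕ → ℝ} (hγpos : ∀ n, 0 < γ n) (hx0 : 0 < x 0) (hy0 : 0 < y 0)
    (hx : ∀ n, x (n + 1) = x n / y n) (hy : ∀ n, y (n + 1) = x n + γ n * y n) (n : ℕ) :
    0 < x n ∧ 0 < y n := by
  induction n with
  | zero => exact ⟨hx0, hy0⟩
  | succ n ih =>
    obtain ⟨hxn, hyn⟩ := ih
    have := hγpos n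
    rw [hx, hy]
    constructor <;> positivity

lemma wseq_eq_add_mul_wseq_succ {γ x y : ℕ → ℝ} (hx : ∀ n, x (n + 1) = x n / y n)
    (hy : ∀ n, y (n + 1) = x n + γ n * y n) (hy_pos : ∀ n, 0 < y n) (n : ℕ) :
    wseq γ x y n = x (n + 1) + γ (n - 1) * wseq γ x y (n + 1) := by
  have hyn := (hy_pos n).ne'
  have hw : wseq γ x y (n + 1) = 1 / y n := by
    rw [wseq, div_eq_div_iff (hy_pos (n + 1)).ne' hyn, Nat.add_sub_cancel, hx, hy]
    field_simp
    ring
  rw [hw, wseq, hx]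
  ring

/-- For every solution with positive initial conditions, for all `i ≥ 0` and `n ≥ 1`,
`wᵢ = (xᵢ + γ_{i-1})/yᵢ = φ(i,n) + μ(i,n+1) w_{i+n}`. -/
theorem stmt3 (γ x y : ℕ → ℝ)
    (hγpos : ∀ n, 0 < γ n)
    (hx0 : 0 < x 0) (hy0 : 0 < y 0)
    (hx : ∀ n, x (n + 1) = x n / y n)
    (hy : ∀ n, y (n + 1) = x n + γ n * y n) :
    ∀ i : ℕ, ∀ n : ℕ, 1 ≤ n →
      wseq γ x y i = (x i + γ (i - 1)) / y i ∧
      wseq γ x y i = phi γ x i n + mu γ i (n + 1) * wseq γ x y (i + n) := by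
  have hstep := wseq_eq_add_mul_wseq_succ hx hy
    fun n => (solution_pos hγpos hx0 hy0 hx hy n).2
  intro i n _
  refine ⟨by rw [wseq, add_comm], ?_⟩
  clear * - hstep
  induction n with
  | zero => simp [phi, mu]
  | succ n ih =>
    rw [ih, hstep (i + n), phi_succ, mu_add_two, ← add_assoc i n 1]
    ring
end

section
/- Suppose γ_n = γ > 1 for all n ≥ 0 (constant coefficient). Then every solution {(x_n, y_n)}_{n=0}^∞ of the system with positive initial conditions satisfies x_n → 0 and y_n → +∞ as n → ∞; in particular the solution is unbounded. -/
open Filter Topology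

/-- If `γₙ = c > 1` is constant, then every solution with positive initial conditions
satisfies `xₙ → 0` and `yₙ → +∞`; in particular the solution is unbounded. -/
theorem stmt11 (γ x y : ℕ → ℝ) (c : ℝ) (hc : 1 < c) (hγc : ∀ n, γ n = c)
    (hγpos : ∀ n, 0 < γ n)
    (hx0 : 0 < x 0) (hy0 : 0 < y 0)
    (hx : ∀ n, x (n + 1) = x n / y n)
    (hy : ∀ n, y (n + 1) = x n + γ n * y n) :
    Filter.Tendsto x Filter.atTop (nhds 0) ∧ Filter.Tendsto y Filter.atTop Filter.atTop := by
  have hpos : ∀ n, 0 < x n ∧ 0 < y n := by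
    intro n
    induction n with
    | zero => exact ⟨hx0, hy0⟩
    | succ k ih =>
      rw [hx, hy]
      exact ⟨div_pos ih.1 ih.2, add_pos ih.1 (mul_pos (hγpos k) ih.2)⟩
  have hgeom : ∀ n, c ^ n * y 0 ≤ y n := by
    intro n
    induction n with
    | zero => simp
    | succ k ih =>
      rw [hy, hγc, pow_succ']
      nlinarith [(hpos k).1]
  have hytop : Tendsto y atTop atTop :=
    tendsto_atTop_mono hgeom ((tendsto_pow_atTop_atTop_of_one_lt hc).atTop_mul_const hy0)
  refine ⟨?_, hytop⟩
  have hratio : Tendsto (fun n => ‖x (n + 1)‖ / ‖x n‖) atTop (𝓝 0) := by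
    refine (tendsto_inv_atTop_zero.comp hytop).congr fun n => ?_
    have hxn := (hpos n).1
    have hyn := (hpos n).2
    rw [Real.norm_of_nonneg (hpos (n + 1)).1.le, Real.norm_of_nonneg hxn.le, hx]
    simp only [Function.comp_apply]
    field_simp
  exact (summable_of_ratio_test_tendsto_lt_one zero_lt_one
    (Eventually.of_forall fun n => (hpos n).1.ne') hratio).tendsto_atTop_zero
end

section
/- Suppose γ_n = 1 for all n ≥ 0. Then every solution {(x_n, y_n)}_{n=0}^∞ of the system with positive initial conditions satisfies the invariant identity x_n + y_n + x_n/y_n + 1/y_n = x_0 + y_0 + x_0/y_0 + 1/y_0 = A for all n ≥ 0, and moreover A > 2. -/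
open Filter Topology

/-- If `γₙ = 1` for all `n`, then every solution with positive initial conditions satisfies
the invariant `xₙ + yₙ + xₙ/yₙ + 1/yₙ = x₀ + y₀ + x₀/y₀ + 1/y₀ = A` for all `n`, and `A > 2`. -/
theorem stmt12 (γ x y : ℕ → ℝ) (hγ1 : ∀ n, γ n = 1)
    (hγpos : ∀ n, 0 < γ n)
    (hx0 : 0 < x 0) (hy0 : 0 < y 0)
    (hx : ∀ n, x (n + 1) = x n / y n)
    (hy : ∀ n, y (n + 1) = x n + γ n * y n) :
    (∀ n : ℕ, x n + y n + x n / y n + 1 / y n = x 0 + y 0 + x 0 / y 0 + 1 / y 0) ∧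
    2 < x 0 + y 0 + x 0 / y 0 + 1 / y 0 := by
  have pos : ∀ n, 0 < x n ∧ 0 < y n := by
    intro n
    induction n with
    | zero => exact ⟨hx0, hy0⟩
    | succ k ih =>
      obtain ⟨hxk, hyk⟩ := ih
      have hγk := hγpos k
      rw [hx, hy]
      exact ⟨by positivity, by positivity⟩
  refine ⟨fun n => ?_, ?_⟩
  · induction n with
    | zero => rfl
    | succ k ih =>
      obtain ⟨hxk, hyk⟩ := pos k
      rw [← ih, hx, hy, hγ1]
      have hsum : x k + 1 * y k ≠ 0 := by positivity
      field_simp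
      ring
  · have hdiv : 0 < x 0 / y 0 := by positivity
    have hamgm : 2 ≤ y 0 + 1 / y 0 := by
      rw [← sub_nonneg]
      have hsq : y 0 + 1 / y 0 - 2 = (y 0 - 1) ^ 2 / y 0 := by
        field_simp
        ring
      rw [hsq]
      positivity
    linarith
end

section
/- Suppose γ_n = 1 for all n ≥ 0, and let {(x_n, y_n)}_{n=0}^∞ be a solution of the system with positive initial conditions. Set A := x_0 + y_0 + x_0/y_0 + 1/y_0 (so A > 2). Then x_n → 0 and y_n → (A + √(A² − 4))/2 as n → ∞; in particular the solution is bounded. -/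
open Filter Topology

/-- The quantity `x + y + x / y + 1 / y` is invariant under `(x, y) ↦ (x / y, x + y)`. -/
theorem invariant_step {a b : ℝ} (ha : 0 < a) (hb : 0 < b) :
    a / b + (a + b) + a / b / (a + b) + 1 / (a + b) = a + b + a / b + 1 / b := by
  have hab : a + b ≠ 0 := by positivity
  field_simp
  ring

/-- A real `L ≥ 1` with `L + 1 / L = A` is the larger root of `t ^ 2 - A * t + 1`. -/
theorem eq_larger_root {L A : ℝ} (hL : 1 ≤ L) (h : L + 1 / L = A) :
    L = (A + Real.sqrt (A ^ 2 - 4)) / 2 := by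
  have hL0 : 0 < L := by linarith
  have hinv : 1 / L ≤ 1 := (div_le_one hL0).2 hL
  have hsq : A ^ 2 - 4 = (L - 1 / L) ^ 2 := by
    rw [← h]
    field_simp
    ring
  rw [hsq, Real.sqrt_sq (by linarith), ← h]
  ring

/-- If `γₙ = 1` for all `n` and `A := x₀ + y₀ + x₀/y₀ + 1/y₀` (so `A > 2`), then
`xₙ → 0` and `yₙ → (A + √(A² − 4))/2`; in particular the solution is bounded. -/
theorem stmt13 (γ x y : ℕ → ℝ) (hγ1 : ∀ n, γ n = 1)
    (hγpos : ∀ n, 0 < γ n)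
    (hx0 : 0 < x 0) (hy0 : 0 < y 0)
    (hx : ∀ n, x (n + 1) = x n / y n)
    (hy : ∀ n, y (n + 1) = x n + γ n * y n)
    (A : ℝ) (hA : A = x 0 + y 0 + x 0 / y 0 + 1 / y 0) :
    2 < A ∧
    Filter.Tendsto x Filter.atTop (nhds 0) ∧
    Filter.Tendsto y Filter.atTop (nhds ((A + Real.sqrt (A ^ 2 - 4)) / 2)) ∧
    ∃ B : ℝ, 0 < B ∧ ∀ n, x n ≤ B ∧ y n ≤ B := by
  have hy' : ∀ n, y (n + 1) = x n + y n := fun n => by rw [hy, hγ1, one_mul]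
  have hpos : ∀ n, 0 < x n ∧ 0 < y n := by
    intro n
    induction n with
    | zero => exact ⟨hx0, hy0⟩
    | succ k ih => exact ⟨hx k ▸ div_pos ih.1 ih.2, hy' k ▸ add_pos ih.1 ih.2⟩
  have hinv : ∀ n, x n + y n + x n / y n + 1 / y n = A := by
    intro n
    induction n with
    | zero => exact hA.symm
    | succ k ih => rw [hx, hy', invariant_step (hpos k).1 (hpos k).2, ih]
  have hbound : ∀ n, x n ≤ A ∧ y n ≤ A := by
    intro n
    have h := hinv n
    obtain ⟨hxn, hyn⟩ := hpos n
    have h₁ : 0 < x n / y n := div_pos hxn hyn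
    have h₂ : 0 < 1 / y n := one_div_pos.2 hyn
    constructor <;> linarith
  have hA2 : 2 < A := by
    have h₁ : 0 < x 0 / y 0 := div_pos hx0 hy0
    have h₂ : 2 ≤ y 0 + 1 / y 0 := by
      have h₃ : y 0 + 1 / y 0 - 2 = (y 0 - 1) ^ 2 / y 0 := by
        field_simp
        ring
      have h₄ : 0 ≤ (y 0 - 1) ^ 2 / y 0 := by positivity
      linarith
    linarith
  have hmono : Monotone y := monotone_nat_of_le_succ fun n => by
    rw [hy']
    linarith [(hpos n).1]
  have hbdd : BddAbove (Set.range y) := ⟨A, Set.forall_mem_range.2 fun n => (hbound n).2⟩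
  obtain ⟨L, hL⟩ : ∃ L, Tendsto y atTop (𝓝 L) := ⟨_, tendsto_atTop_ciSup hmono hbdd⟩
  have hyL : ∀ n, y n ≤ L := hmono.ge_of_tendsto hL
  have hL0 : 0 < L := hy0.trans_le (hyL 0)
  have hxlim : Tendsto x atTop (𝓝 0) := by
    have h := (hL.comp (tendsto_add_atTop_nat 1)).sub hL
    rw [sub_self] at h
    refine h.congr fun n => ?_
    simp [hy']
  have hL1 : 1 ≤ L := by
    by_contra! hlt
    have hxmono : Monotone x := monotone_nat_of_le_succ fun n => by
      rw [hx, le_div_iff₀ (hpos n).2]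
      nlinarith [hpos n, hyL n]
    exact hx0.not_ge (hxmono.ge_of_tendsto hxlim 0)
  have hroot : L + 1 / L = A := by
    have h := ((hxlim.add hL).add (hxlim.div hL hL0.ne')).add
      (tendsto_const_nhds (x := (1 : ℝ)).div hL hL0.ne')
    have h' := tendsto_nhds_unique (h.congr hinv) tendsto_const_nhds
    simpa using h'
  exact ⟨hA2, hxlim, eq_larger_root hL1 hroot ▸ hL, A, by linarith, hbound⟩
end
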